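/- Let (Ω,P,π) be a finite irreducible reversible Markov chain with lazy version P_L := (I+P)/2 and heat kernel H_t := exp(t(P−I)), and let x,y ∈ Ω. Then for every t ∈ ℕ, P_L^t(x,y) ≥ π(y)·P_x[T_y ≤ t], where P_x[T_y ≤ t] is the probability that the P_L-chain started at x hits y by time t; and for every real t ≥ 0, H_t(x,y) ≥ π(y)·H_x[T_y < t], where H_x[T_y < t] is the probability that the continuous-time chain started at x hits y before time t. -/

import Mathlib

open Filter Finset

noncomputable section

variable {V : Type} [Fintype V] [DecidableEq V]

/-- `P` is a row-stochastic matrix. -/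
def IsStoch (P : Matrix V V ℝ) : Prop :=
  (∀ i j, 0 ≤ P i j) ∧ ∀ i, ∑ j, P i j = 1

/-- `π` is a probability vector with full support. -/
def IsProb (π : V → ℝ) : Prop := (∀ i, 0 < π i) ∧ ∑ i, π i = 1

/-- reversibility: `π x * P x y = π y * P y x`. -/
def Rev (P : Matrix V V ℝ) (π : V → ℝ) : Prop := ∀ i j, π i * P i j = π j * P j i

/-- irreducibility -/
def Irred (P : Matrix V V ℝ) : Prop := ∀ i j, ∃ t : ℕ, 0 < (P ^ t) i j

/-- the lazy version `(I + P)/2` of a chain -/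
def lazyM (P : Matrix V V ℝ) : Matrix V V ℝ := (2 : ℝ)⁻¹ • (1 + P)

/-- total variation distance -/
def tvDist (μ ν : V → ℝ) : ℝ := (∑ x, |μ x - ν x|) / 2

/-- worst-case total variation distance from stationarity at time `t` -/
def dTV (P : Matrix V V ℝ) (π : V → ℝ) (t : ℕ) : ℝ := ⨆ x, tvDist ((P ^ t) x) π

/-- the `ε` total-variation mixing time -/
def mixTime (P : Matrix V V ℝ) (π : V → ℝ) (ε : ℝ) : ℕ := sInf {t : ℕ | dTV P π t ≤ ε}

/-- worst-case separation distance at time `t` -/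
def dSep (P : Matrix V V ℝ) (π : V → ℝ) (t : ℕ) : ℝ := 1 - ⨅ x, ⨅ y, ((P ^ t) x y) / π y

/-- the `ε` separation time -/
def sepTime (P : Matrix V V ℝ) (π : V → ℝ) (ε : ℝ) : ℕ := sInf {t : ℕ | dSep P π t ≤ ε}

/-- the heat kernel `H_t = exp (t (P - I))` of the associated continuous-time chain -/
def heatKer (P : Matrix V V ℝ) (t : ℝ) : Matrix V V ℝ :=
  ∑' k : ℕ, (t ^ k / (Nat.factorial k : ℝ)) • ((P - 1) ^ k)

/-- separation distance of the continuous-time chain -/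
def dSepC (P : Matrix V V ℝ) (π : V → ℝ) (t : ℝ) : ℝ := 1 - ⨅ x, ⨅ y, (heatKer P t) x y / π y

/-- the `ε` separation time of the continuous-time chain -/
def sepTimeC (P : Matrix V V ℝ) (π : V → ℝ) (ε : ℝ) : ℝ := sInf {t : ℝ | 0 ≤ t ∧ dSepC P π t ≤ ε}

/-- degree of a vertex -/
def deg (G : SimpleGraph V) (v : V) : ℕ := Nat.card {u // G.Adj v u}

open Classical in
/-- transition matrix of the lazy simple random walk on `G` -/
def walkMat (G : SimpleGraph V) : Matrix V V ℝ :=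
  Matrix.of fun v u => if v = u then 1/2 else if G.Adj v u then 1 / (2 * (deg G v : ℝ)) else 0

/-- stationary distribution of the (lazy) simple random walk on `G` -/
def degSta (G : SimpleGraph V) (v : V) : ℝ := (deg G v : ℝ) / ∑ u, (deg G u : ℝ)

/-- the `ε` total-variation mixing time of the lazy simple random walk on `G` -/
def tmixG (G : SimpleGraph V) (ε : ℝ) : ℕ := mixTime (walkMat G) (degSta G) ε

/-- the second largest eigenvalue of a reversible transition matrix -/
def lam2 (P : Matrix V V ℝ) : ℝ :=
  sSup {μ : ℝ | μ ≠ 1 ∧ ∃ f : V → ℝ, f ≠ 0 ∧ P.mulVec f = μ • f}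

/-- the relaxation time `1/(1-λ₂)` -/
def trel (P : Matrix V V ℝ) : ℝ := 1 / (1 - lam2 P)

/-- the relaxation time of the lazy simple random walk on `G` -/
def trelG (G : SimpleGraph V) : ℝ := trel (walkMat G)

/-- transition matrix of the lazy random walk on the network with edge weights `w` -/
def wMat (w : V → V → ℝ) : Matrix V V ℝ :=
  Matrix.of fun v u => if v = u then 1/2 else w v u / (2 * ∑ x, w v x)

/-- stationary distribution of the lazy random walk on the network with edge weights `w` -/
def wSta (w : V → V → ℝ) (v : V) : ℝ := (∑ x, w v x) / ∑ u, ∑ x, w u x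

/-- `w` is a valid system of edge weights on the graph `G`: symmetric, positive on edges
and vanishing off the edges. -/
def GoodWeights (G : SimpleGraph V) (w : V → V → ℝ) : Prop :=
  (∀ u v, w u v = w v u) ∧ (∀ u v, G.Adj u v → 0 < w u v) ∧ ∀ u v, ¬ G.Adj u v → w u v = 0

/-- the `ε` total-variation mixing time of the lazy random walk on the weighted network -/
def tmixW (w : V → V → ℝ) (ε : ℝ) : ℕ := mixTime (wMat w) (wSta w) ε

/-- the probability of a discrete trajectory -/
def pathProb (P : Matrix V V ℝ) {k : ℕ} (w : Fin (k+1) → V) : ℝ :=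
  ∏ i : Fin k, P (w i.castSucc) (w i.succ)

/-- `P_x[T_y = k]`: probability that the chain started at `x` first hits `y` at time `k` -/
def firstHit (P : Matrix V V ℝ) (x y : V) (k : ℕ) : ℝ :=
  ∑ w : Fin (k+1) → V,
    if w 0 = x ∧ w (Fin.last k) = y ∧ ∀ i : Fin k, w i.castSucc ≠ y then pathProb P w else 0

/-- the restriction of `P - I` to the complement of `y` -/
def restrQ (P : Matrix V V ℝ) (y : V) : Matrix {w : V // w ≠ y} {w : V // w ≠ y} ℝ :=
  Matrix.of fun a b => P a.1 b.1 - if a = b then 1 else 0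

/-- `exp (t A)` where `A` is the restriction of `P - I` to the complement of `y` -/
def heatRestr (P : Matrix V V ℝ) (y : V) (t : ℝ) :
    Matrix {w : V // w ≠ y} {w : V // w ≠ y} ℝ :=
  ∑' k : ℕ, (t ^ k / (Nat.factorial k : ℝ)) • (restrQ P y ^ k)

/-- `P_x[T_B < r]` for the chain `P`: the probability that the set `B` is hit before time `r` -/
def hitByTime (P : Matrix V V ℝ) (B : Finset V) (x : V) (r : ℕ) : ℝ :=
  ∑ k ∈ Finset.range r, ∑ w : Fin (k+1) → V,
    if w 0 = x ∧ w (Fin.last k) ∈ B ∧ ∀ i : Fin k, w i.castSucc ∉ B then pathProb P w else 0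


/-- `P_x[T_y ≤ t]` for the lazy chain: the probability that the `P_L`-chain started at `x`
hits `y` by time `t`. -/
def hitProbLe (P : Matrix V V ℝ) (x y : V) (t : ℕ) : ℝ :=
  ∑ k ∈ Finset.range (t+1), firstHit P x y k

/-- `H_x[T_y < t]` for the continuous-time chain:
`1 - Σ_{w ≠ y} [exp(tA)]_{x,w}` where `A` is the restriction of `P - I` to the complement of
`y` (and `1` if `x = y`). -/
def ctsHitProb (P : Matrix V V ℝ) (x y : V) (t : ℝ) : ℝ :=
  if h : x = y then 1
  else 1 - ∑ w : {w : V // w ≠ y}, heatRestr P y t ⟨x, h⟩ w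

lemma IsStoch.lazyM {P : Matrix V V ℝ} (hP : IsStoch P) : IsStoch (lazyM P) := by
  refine ⟨fun i j => ?_, fun i => ?_⟩
  · have h1 : (0 : ℝ) ≤ (1 : Matrix V V ℝ) i j := by
      rw [Matrix.one_apply]; split_ifs <;> norm_num
    have h2 := hP.1 i j
    simp only [_root_.lazyM, Matrix.smul_apply, Matrix.add_apply, smul_eq_mul]
    positivity
  · simp only [_root_.lazyM, Matrix.smul_apply, Matrix.add_apply, smul_eq_mul, ← Finset.mul_sum,
      Finset.sum_add_distrib, hP.2 i, Matrix.one_apply, Finset.sum_ite_eq, Finset.mem_univ, if_true]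
    norm_num

lemma IsStoch.pow {P : Matrix V V ℝ} (hP : IsStoch P) (t : ℕ) : IsStoch (P ^ t) := by
  induction t with
  | zero =>
    refine ⟨fun i j => ?_, fun i => ?_⟩
    · rw [pow_zero, Matrix.one_apply]; split_ifs <;> norm_num
    · simp [Matrix.one_apply]
  | succ t ih =>
    refine ⟨fun i j => ?_, fun i => ?_⟩
    · rw [pow_succ', Matrix.mul_apply]
      exact Finset.sum_nonneg fun z _ => mul_nonneg (hP.1 i z) (ih.1 z j)
    · simp only [pow_succ', Matrix.mul_apply]
      rw [Finset.sum_comm]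
      simp only [← Finset.mul_sum, ih.2, mul_one, hP.2]

lemma Rev.lazyM {P : Matrix V V ℝ} {π : V → ℝ} (h : Rev P π) : Rev (lazyM P) π := by
  intro i j
  have h1 := h i j
  simp only [_root_.lazyM, Matrix.smul_apply, Matrix.add_apply, smul_eq_mul, Matrix.one_apply]
  by_cases hij : i = j
  · subst hij; rfl
  · rw [if_neg hij, if_neg (Ne.symm hij)]; linarith

lemma Rev.pow {P : Matrix V V ℝ} {π : V → ℝ} (h : Rev P π) (t : ℕ) : Rev (P ^ t) π := by
  induction t with
  | zero =>
    intro i j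
    rw [pow_zero, Matrix.one_apply, Matrix.one_apply]
    by_cases hij : i = j
    · subst hij; rfl
    · simp [hij, Ne.symm hij]
  | succ t ih =>
    intro i j
    conv_lhs => rw [pow_succ']
    rw [pow_succ, Matrix.mul_apply, Matrix.mul_apply, Finset.mul_sum, Finset.mul_sum]
    refine Finset.sum_congr rfl fun z _ => ?_
    linear_combination (P ^ t) z j * h i z + P z i * ih z j

lemma Rev.sum_mul_mulVec {M : Matrix V V ℝ} {π : V → ℝ} (h : Rev M π) (f g : V → ℝ) :
    ∑ x, π x * f x * M.mulVec g x = ∑ x, π x * M.mulVec f x * g x := by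
  simp only [Matrix.mulVec, dotProduct, Finset.mul_sum, Finset.sum_mul]
  rw [Finset.sum_comm]
  refine Finset.sum_congr rfl fun x _ => Finset.sum_congr rfl fun z _ => ?_
  linear_combination f z * g x * h z x

/-- The lazy version of a reversible chain is positive semidefinite in `ℓ²(π)`. -/
lemma sum_mul_lazyM_mulVec_nonneg {P : Matrix V V ℝ} {π : V → ℝ} (hP : IsStoch P)
    (hπ : ∀ x, 0 ≤ π x) (h : Rev P π) (g : V → ℝ) :
    0 ≤ ∑ x, π x * g x * (lazyM P).mulVec g x := by
  have hrow : ∑ x, ∑ z, π x * P x z * g x ^ 2 = ∑ x, π x * g x ^ 2 := by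
    refine Finset.sum_congr rfl fun x _ => ?_
    rw [← Finset.sum_mul, ← Finset.mul_sum, hP.2, mul_one]
  have hcol : ∑ x, ∑ z, π x * P x z * g z ^ 2 = ∑ x, π x * g x ^ 2 := by
    rw [Finset.sum_comm, ← hrow]
    exact Finset.sum_congr rfl fun x _ => Finset.sum_congr rfl fun z _ => by rw [h z x]
  have hcross : ∑ x, ∑ z, π x * P x z * (g x * g z) = ∑ x, π x * g x * P.mulVec g x := by
    simp only [Matrix.mulVec, dotProduct, Finset.mul_sum]
    exact Finset.sum_congr rfl fun x _ => Finset.sum_congr rfl fun z _ => by ring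
  have hsq : ∑ x, ∑ z, π x * P x z * (g x + g z) ^ 2
      = 2 * ∑ x, π x * g x ^ 2 + 2 * ∑ x, π x * g x * P.mulVec g x := by
    rw [two_mul]
    nth_rewrite 1 [← hrow]
    rw [← hcol, ← hcross, Finset.mul_sum]
    simp only [Finset.mul_sum, ← Finset.sum_add_distrib]
    exact Finset.sum_congr rfl fun x _ => Finset.sum_congr rfl fun z _ => by ring
  have hlazy : ∑ x, π x * g x * (lazyM P).mulVec g x
      = 2⁻¹ * (∑ x, π x * g x ^ 2 + ∑ x, π x * g x * P.mulVec g x) := by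
    rw [← Finset.sum_add_distrib, Finset.mul_sum]
    refine Finset.sum_congr rfl fun x _ => ?_
    simp only [lazyM, Matrix.smul_mulVec, Matrix.add_mulVec, Matrix.one_mulVec, Pi.smul_apply,
      Pi.add_apply, smul_eq_mul]
    ring
  have hpos : 0 ≤ ∑ x, ∑ z, π x * P x z * (g x + g z) ^ 2 :=
    Finset.sum_nonneg fun x _ => Finset.sum_nonneg fun z _ =>
      mul_nonneg (mul_nonneg (hπ x) (hP.1 x z)) (sq_nonneg _)
  rw [hlazy]
  linarith

lemma sum_mul_lazyM_pow_mulVec_nonneg {P : Matrix V V ℝ} {π : V → ℝ} (hP : IsStoch P)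
    (hπ : ∀ x, 0 ≤ π x) (h : Rev P π) (t : ℕ) (f : V → ℝ) :
    0 ≤ ∑ x, π x * f x * (lazyM P ^ t).mulVec f x := by
  obtain ⟨s, rfl | rfl⟩ := Nat.even_or_odd' t
  · rw [two_mul, pow_add, ← Matrix.mulVec_mulVec, (h.lazyM.pow s).sum_mul_mulVec]
    refine Finset.sum_nonneg fun x _ => ?_
    rw [mul_assoc]
    exact mul_nonneg (hπ x) (mul_self_nonneg _)
  · rw [two_mul, add_assoc, pow_add, pow_succ', ← Matrix.mulVec_mulVec,
      (h.lazyM.pow s).sum_mul_mulVec, ← Matrix.mulVec_mulVec]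
    exact sum_mul_lazyM_mulVec_nonneg hP hπ h _

/-- Return probabilities of a lazy reversible chain dominate the stationary mass. -/
lemma stationary_le_lazyM_pow_diag {P : Matrix V V ℝ} {π : V → ℝ} (hP : IsStoch P)
    (hπ : IsProb π) (h : Rev P π) (t : ℕ) (y : V) : π y ≤ (lazyM P ^ t) y y := by
  have hpos := sum_mul_lazyM_pow_mulVec_nonneg hP (fun x => (hπ.1 x).le) h t
    (Pi.single y 1 - fun _ => π y)
  have hone : (lazyM P ^ t).mulVec (fun _ => π y) = fun _ => π y := by
    ext x
    simp only [Matrix.mulVec, dotProduct, ← Finset.sum_mul, (hP.lazyM.pow t).2, one_mul]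
  have hstat : ∑ x, π x * (lazyM P ^ t) x y = π y := by
    simp only [(h.lazyM.pow t) _ y, ← Finset.mul_sum, (hP.lazyM.pow t).2, mul_one]
  rw [Matrix.mulVec_sub, hone] at hpos
  simp only [Pi.sub_apply, Matrix.mulVec_single_one, Matrix.col_apply] at hpos
  have hexp : ∑ x, π x * ((Pi.single y 1 : V → ℝ) x - π y) * ((lazyM P ^ t) x y - π y)
      = π y * ((lazyM P ^ t) y y - π y) := by
    have : ∀ x, π x * ((Pi.single y 1 : V → ℝ) x - π y) * ((lazyM P ^ t) x y - π y)
        = (if x = y then π x * ((lazyM P ^ t) x y - π y) else 0)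
          - π y * (π x * (lazyM P ^ t) x y) + π y * π y * π x := by
      intro x
      rw [Pi.single_apply]
      split_ifs <;> ring
    simp only [this, Finset.sum_add_distrib, Finset.sum_sub_distrib, ← Finset.mul_sum, hstat, hπ.2,
      Finset.sum_ite_eq', Finset.mem_univ, if_true]
    ring
  rw [hexp] at hpos
  have := nonneg_of_mul_nonneg_right hpos (hπ.1 y)
  linarith

/-- A function satisfying the one-step recursion of the hitting probabilities of `y` is dominated
by the kernel of the lazy chain divided by the stationary mass. -/
lemma mul_le_lazyM_pow_of_recursion {P : Matrix V V ℝ} {π : V → ℝ} (hP : IsStoch P)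
    (hπ : IsProb π) (hrev : Rev P π) (y : V) (f : ℕ → V → ℝ) (hy : ∀ t, f t y = 1)
    (h0 : ∀ x, x ≠ y → f 0 x = 0)
    (hstep : ∀ t x, x ≠ y → f (t + 1) x = ∑ z, lazyM P x z * f t z) (t : ℕ) (x : V) :
    π y * f t x ≤ (lazyM P ^ t) x y := by
  induction t generalizing x with
  | zero =>
    by_cases hx : x = y
    · subst hx
      simpa [hy] using stationary_le_lazyM_pow_diag hP hπ hrev 0 x
    · simp [h0 x hx, hx]
  | succ t ih =>
    by_cases hx : x = y
    · subst hx
      simpa [hy] using stationary_le_lazyM_pow_diag hP hπ hrev (t + 1) x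
    · rw [hstep t x hx, pow_succ', Matrix.mul_apply, Finset.mul_sum]
      refine Finset.sum_le_sum fun z _ => ?_
      calc π y * (lazyM P x z * f t z) = lazyM P x z * (π y * f t z) := by ring
        _ ≤ _ := mul_le_mul_of_nonneg_left (ih z) (hP.lazyM.1 x z)

lemma firstHit_zero (P : Matrix V V ℝ) (x y : V) : firstHit P x y 0 = if x = y then 1 else 0 := by
  rw [firstHit, ← (Equiv.funUnique (Fin 1) V).symm.sum_comp]
  simp only [pathProb, Finset.univ_eq_empty, Finset.prod_empty]
  rw [Finset.sum_eq_single x]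
  · simp
  · intro b _ hb
    simp [hb]
  · simp

lemma firstHit_self_succ (P : Matrix V V ℝ) (y : V) (k : ℕ) : firstHit P y y (k + 1) = 0 :=
  Finset.sum_eq_zero fun _ _ => if_neg fun h => h.2.2 0 h.1

lemma firstHit_succ (P : Matrix V V ℝ) {x y : V} (hxy : x ≠ y) (k : ℕ) :
    firstHit P x y (k + 1) = ∑ z, P x z * firstHit P z y k := by
  have hcons : ∀ (a : V) (w : Fin (k + 1) → V),
      (if (Fin.cons a w : Fin (k + 2) → V) 0 = x ∧ (Fin.cons a w : Fin (k + 2) → V) (Fin.last _) = y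
          ∧ (∀ i : Fin (k + 1), (Fin.cons a w : Fin (k + 2) → V) i.castSucc ≠ y)
        then pathProb P (Fin.cons a w : Fin (k + 2) → V) else 0)
      = if a = x then P x (w 0) * (if w (Fin.last k) = y ∧ (∀ i : Fin k, w i.castSucc ≠ y)
          then pathProb P w else 0) else 0 := by
    intro a w
    have hlast : (Fin.cons a w : Fin (k + 2) → V) (Fin.last _) = w (Fin.last k) := by
      rw [← Fin.succ_last, Fin.cons_succ]
    have hprob : pathProb P (Fin.cons a w : Fin (k + 2) → V) = P a (w 0) * pathProb P w := by
      simp only [pathProb]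
      rw [Fin.prod_univ_succ]
      simp
    have hpath : (∀ i : Fin (k + 1), (Fin.cons a w : Fin (k + 2) → V) i.castSucc ≠ y)
        ↔ a ≠ y ∧ ∀ i : Fin k, w i.castSucc ≠ y := by
      rw [Fin.forall_fin_succ]
      simp only [Fin.castSucc_zero, Fin.cons_zero, ← Fin.succ_castSucc, Fin.cons_succ]
    simp only [hlast, hprob, hpath, Fin.cons_zero]
    by_cases ha : a = x
    · subst ha
      simp [hxy]
    · simp [ha]
  rw [firstHit, ← (Fin.consEquiv fun _ : Fin (k + 2) => V).sum_comp, Fintype.sum_prod_type]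
  refine (Finset.sum_congr rfl fun a _ => Finset.sum_congr rfl fun w _ => hcons a w).trans ?_
  rw [Finset.sum_comm]
  simp only [Finset.sum_ite_eq', Finset.mem_univ, if_true]
  simp only [firstHit, Finset.mul_sum]
  rw [Finset.sum_comm]
  refine Finset.sum_congr rfl fun w _ => ?_
  rw [Finset.sum_eq_single (w 0)]
  · simp
  · intro z _ hz
    simp [Ne.symm hz]
  · simp

/-- The restriction of the lazy chain to the complement of `y`. -/
def lazyRestr (P : Matrix V V ℝ) (y : V) : Matrix {w : V // w ≠ y} {w : V // w ≠ y} ℝ :=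
  (lazyM P).submatrix Subtype.val Subtype.val

/-- The probability that the lazy chain killed at `y` has been killed by time `t`. -/
def killProb (P : Matrix V V ℝ) (y : V) (t : ℕ) (x : V) : ℝ :=
  if h : x = y then 1 else 1 - ∑ w, (lazyRestr P y ^ t) ⟨x, h⟩ w

lemma sum_eq_add_sum_ne (f : V → ℝ) (y : V) :
    ∑ z, f z = f y + ∑ z : {w : V // w ≠ y}, f z := by
  rw [← Finset.add_sum_erase _ _ (Finset.mem_univ y)]
  congr 1
  exact Finset.sum_subtype _ (by simp) f

lemma killProb_succ {P : Matrix V V ℝ} (hP : IsStoch P) (y : V) (t : ℕ) {x : V} (hx : x ≠ y) :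
    killProb P y (t + 1) x = ∑ z, lazyM P x z * killProb P y t z := by
  have hrow := hP.lazyM.2 x
  rw [sum_eq_add_sum_ne _ y] at hrow
  rw [sum_eq_add_sum_ne _ y]
  have hkill : ∀ z : {w : V // w ≠ y},
      lazyM P x z * killProb P y t z
        = lazyM P x z - lazyM P x z * ∑ w, (lazyRestr P y ^ t) z w := by
    intro z
    rw [killProb, dif_neg z.2]
    ring
  simp only [hkill, Finset.sum_sub_distrib]
  rw [killProb, dif_neg hx, killProb, dif_pos rfl]
  simp only [pow_succ', Matrix.mul_apply]
  rw [Finset.sum_comm]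
  simp only [← Finset.mul_sum]
  simp only [lazyRestr, Matrix.submatrix_apply]
  linarith

/-- The weight at `k` of the Poisson distribution with mean `c`. -/
def poisWeight (c : ℝ) (k : ℕ) : ℝ := Real.exp (-c) * (c ^ k / (Nat.factorial k : ℝ))

/-- Uniformization: the exponential series of `c (M - 1)` is a Poisson average of powers of `M`. -/
lemma hasSum_uniformization {𝔸 : Type*} [NormedRing 𝔸] [NormedAlgebra ℝ 𝔸] [CompleteSpace 𝔸]
    (M : 𝔸) (c : ℝ) :
    HasSum (fun k : ℕ => poisWeight c k • M ^ k) (NormedSpace.exp (c • (M - 1))) := by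
  let _ : NormedAlgebra ℚ 𝔸 := NormedAlgebra.restrictScalars ℚ ℝ 𝔸
  have h1 : c • (M - 1) = algebraMap ℝ 𝔸 (-c) + c • M := by
    rw [Algebra.algebraMap_eq_smul_one, smul_sub, neg_smul]; abel
  rw [h1, NormedSpace.exp_add_of_commute (Algebra.commutes _ _),
    ← NormedSpace.algebraMap_exp_comm, ← Real.exp_eq_exp_ℝ, ← Algebra.smul_def]
  have := (NormedSpace.exp_series_hasSum_exp' (𝕂 := ℝ) (c • M)).const_smul (Real.exp (-c))
  convert this using 2 with k
  rw [poisWeight, smul_pow, smul_smul, smul_smul]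
  congr 1
  ring

lemma tsum_eq_exp {𝔸 : Type*} [NormedRing 𝔸] [NormedAlgebra ℝ 𝔸] (A : 𝔸) (t : ℝ) :
    ∑' k : ℕ, (t ^ k / (Nat.factorial k : ℝ)) • A ^ k = NormedSpace.exp (t • A) := by
  rw [NormedSpace.exp_eq_tsum ℝ]
  refine tsum_congr fun k => ?_
  rw [smul_pow, smul_smul]
  congr 1
  ring

lemma poisWeight_nonneg {c : ℝ} (hc : 0 ≤ c) (k : ℕ) : 0 ≤ poisWeight c k := by
  unfold poisWeight; positivity

lemma hasSum_poisWeight (c : ℝ) : HasSum (poisWeight c) 1 := by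
  have h := hasSum_uniformization (1 : ℝ) c
  simp only [one_pow, smul_eq_mul, mul_one, sub_self, mul_zero, NormedSpace.exp_zero] at h
  exact h

lemma hasSum_matrix_uniformization {W : Type*} [Fintype W] [DecidableEq W] (M A : Matrix W W ℝ)
    (hA : A = (2 : ℝ) • (M - 1)) (t : ℝ) (a b : W) :
    HasSum (fun k : ℕ => poisWeight (2 * t) k * (M ^ k) a b)
      ((∑' k : ℕ, (t ^ k / (Nat.factorial k : ℝ)) • A ^ k) a b) := by
  let _ : NormedRing (Matrix W W ℝ) := Matrix.linftyOpNormedRing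
  let _ : NormedAlgebra ℝ (Matrix W W ℝ) := Matrix.linftyOpNormedAlgebra
  have h := hasSum_uniformization M (2 * t)
  have h2 : (2 * t) • (M - 1) = t • A := by rw [hA, smul_smul, mul_comm]
  rw [h2, ← tsum_eq_exp] at h
  exact Pi.hasSum.mp (Pi.hasSum.mp h a) b

lemma hasSum_heatKer (P : Matrix V V ℝ) (t : ℝ) (x y : V) :
    HasSum (fun k : ℕ => poisWeight (2 * t) k * (lazyM P ^ k) x y) (heatKer P t x y) := by
  refine hasSum_matrix_uniformization _ _ ?_ t x y
  ext i j
  simp only [lazyM, Matrix.smul_apply, Matrix.sub_apply, Matrix.add_apply, smul_eq_mul]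
  ring

lemma hasSum_heatRestr (P : Matrix V V ℝ) (y : V) (t : ℝ) (a b : {w : V // w ≠ y}) :
    HasSum (fun k : ℕ => poisWeight (2 * t) k * (lazyRestr P y ^ k) a b) (heatRestr P y t a b) := by
  refine hasSum_matrix_uniformization _ _ ?_ t a b
  ext i j
  simp only [restrQ, lazyRestr, lazyM, Matrix.smul_apply, Matrix.sub_apply, Matrix.add_apply,
    Matrix.submatrix_apply, Matrix.of_apply, Matrix.one_apply, smul_eq_mul, Subtype.ext_iff]
  ring

lemma hasSum_ctsHitProb (P : Matrix V V ℝ) (x y : V) (t : ℝ) :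
    HasSum (fun k : ℕ => poisWeight (2 * t) k * killProb P y k x) (ctsHitProb P x y t) := by
  by_cases h : x = y
  · simpa [killProb, ctsHitProb, h] using hasSum_poisWeight (2 * t)
  · simp only [killProb, ctsHitProb, dif_neg h, mul_sub, mul_one, Finset.mul_sum]
    exact (hasSum_poisWeight (2 * t)).sub (hasSum_sum fun w _ => hasSum_heatRestr P y t ⟨x, h⟩ w)

/-- **Eq. (3.2) of Lemma 3.2.** `P_L^t(x,y) ≥ π(y) P_x[T_y ≤ t]` and
`H_t(x,y) ≥ π(y) H_x[T_y < t]`. -/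
theorem kernel_lower_bound_by_hitting
    {N : ℕ} (P : Matrix (Fin N) (Fin N) ℝ) (π : Fin N → ℝ)
    (hP : IsStoch P) (hπ : IsProb π) (hrev : Rev P π) (hirr : Irred P)
    (x y : Fin N) :
    (∀ t : ℕ, π y * hitProbLe (lazyM P) x y t ≤ (lazyM P ^ t) x y) ∧
    (∀ t : ℝ, 0 ≤ t → π y * ctsHitProb P x y t ≤ heatKer P t x y) := by
  refine ⟨fun t => ?_, fun t ht => ?_⟩
  · refine mul_le_lazyM_pow_of_recursion hP hπ hrev y (fun t x => hitProbLe (lazyM P) x y t)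
      (fun t => ?_) (fun x hx => ?_) (fun t x hx => ?_) t x
    · simp [hitProbLe, Finset.sum_range_succ', firstHit_self_succ, firstHit_zero]
    · simp [hitProbLe, firstHit_zero, hx]
    · simp only [hitProbLe, Finset.mul_sum]
      rw [Finset.sum_range_succ', firstHit_zero, if_neg hx, add_zero, Finset.sum_comm]
      exact Finset.sum_congr rfl fun k _ => firstHit_succ _ hx k
  · refine hasSum_le (fun k => ?_) ((hasSum_ctsHitProb P x y t).mul_left (π y))
      (hasSum_heatKer P t x y)
    rw [mul_left_comm]
    refine mul_le_mul_of_nonneg_left ?_ (poisWeight_nonneg (by positivity) k)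
    refine mul_le_lazyM_pow_of_recursion hP hπ hrev y (killProb P y) (fun t => ?_)
      (fun x hx => ?_) (fun t x hx => killProb_succ hP y t hx) k x
    · simp [killProb]
    · simp [killProb, hx, Matrix.one_apply]

end
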